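/- Let ρ_{BC|A} be a CJ channel operator indexed by (b × c) × a such that the quantum conditional mutual information I(B:C|A), evaluated on the trace-one operator ρ̂ := (1 / card a) · ρ_{BC|A} with systems grouped as (B, C, A), equals 0. Then ρ_{BC|A} admits a common-cause block form. (Theorem 3, implication from condition 3 to condition 4.) -/

import Mathlib

open Matrix BigOperators
open scoped ComplexOrder

noncomputable section

/-- Partial trace over the first tensor factor. -/
def ptrace₁ {α β : Type*} [Fintype α] (M : Matrix (α × β) (α × β) ℂ) : Matrix β β ℂ :=
  Matrix.of fun j j' => ∑ i, M (i, j) (i, j')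

/-- Partial trace over the second tensor factor. -/
def ptrace₂ {α β : Type*} [Fintype β] (M : Matrix (α × β) (α × β) ℂ) : Matrix α α ℂ :=
  Matrix.of fun i i' => ∑ j, M (i, j) (i', j)

/-- `M` is a Choi–Jamiołkowski channel operator from `a` to `b`: positive semidefinite with
partial trace over the output equal to the identity. -/
def IsCJChannel {b a : Type*} [Fintype b] [Fintype a] [DecidableEq a]
    (M : Matrix (b × a) (b × a) ℂ) : Prop :=
  M.PosSemidef ∧ ptrace₁ M = 1

/-- The marginal `ρ_{B|A}` of a channel operator `ρ_{BC|A}` (partial trace over `C`). -/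
def margB {b c a : Type*} [Fintype c] (ρ : Matrix ((b × c) × a) ((b × c) × a) ℂ) :
    Matrix (b × a) (b × a) ℂ :=
  Matrix.of fun p q => ∑ γ, ρ ((p.1, γ), p.2) ((q.1, γ), q.2)

/-- The marginal `ρ_{C|A}` of a channel operator `ρ_{BC|A}` (partial trace over `B`). -/
def margC {b c a : Type*} [Fintype b] (ρ : Matrix ((b × c) × a) ((b × c) × a) ℂ) :
    Matrix (c × a) (c × a) ℂ :=
  Matrix.of fun p q => ∑ β, ρ ((β, p.1), p.2) ((β, q.1), q.2)

/-- Extension `↑ρ_{B|A}` of a marginal to the full space, tensoring with the identity on `C`. -/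
def extB {b c a : Type*} [DecidableEq c] (M : Matrix (b × a) (b × a) ℂ) :
    Matrix ((b × c) × a) ((b × c) × a) ℂ :=
  Matrix.of fun p q => M (p.1.1, p.2) (q.1.1, q.2) * (if p.1.2 = q.1.2 then 1 else 0)

/-- Extension `↑ρ_{C|A}` of a marginal to the full space, tensoring with the identity on `B`. -/
def extC {b c a : Type*} [DecidableEq b] (M : Matrix (c × a) (c × a) ℂ) :
    Matrix ((b × c) × a) ((b × c) × a) ℂ :=
  Matrix.of fun p q => M (p.1.2, p.2) (q.1.2, q.2) * (if p.1.1 = q.1.1 then 1 else 0)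

/-- The Choi–Jamiołkowski operator of a (unitary) matrix `U`. -/
def cjOf {y x : Type*} (U : Matrix y x ℂ) : Matrix (y × x) (y × x) ℂ :=
  Matrix.of fun p q => U p.1 p.2 * star (U q.1 q.2)

/-- A (possibly rectangular-typed) matrix is unitary if both `U Uᴴ = 1` and `Uᴴ U = 1`. -/
def IsUnitaryMat {y x : Type*} [Fintype y] [Fintype x] [DecidableEq y] [DecidableEq x]
    (U : Matrix y x ℂ) : Prop :=
  U * Uᴴ = 1 ∧ Uᴴ * U = 1

/-- von Neumann entropy of a matrix (junk value `0` if not Hermitian);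
`Real.log 0 = 0` gives the usual convention `0 log 0 = 0`. -/
def vNEntropy {n : Type*} [Fintype n] (M : Matrix n n ℂ) : ℝ :=
  letI := Classical.decEq n
  if h : M.IsHermitian then -∑ i, h.eigenvalues i * Real.log (h.eigenvalues i) else 0

/-- Quantum conditional mutual information `I(B:C|A)` of a matrix on `(b × c) × a`,
with systems grouped as `B`, `C`, `A`. -/
def qcmiBCA {b c a : Type*} [Fintype b] [Fintype c] [Fintype a]
    (ρ : Matrix ((b × c) × a) ((b × c) × a) ℂ) : ℝ :=
  vNEntropy (margB ρ) + vNEntropy (margC ρ) - vNEntropy ρ - vNEntropy (ptrace₁ ρ)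

/-- Conjugation of `ρ` on its `A` indices by a matrix `V` from `a` to `σa`. -/
def conjOnA {o σa a : Type*} [Fintype a] (ρ : Matrix (o × a) (o × a) ℂ)
    (V : Matrix σa a ℂ) : Matrix (o × σa) (o × σa) ℂ :=
  Matrix.of fun p q => ∑ x : a, ∑ x' : a, V p.2 x * ρ (p.1, x) (q.1, x') * star (V q.2 x')

section
variable {b c a : Type*} [Fintype b] [Fintype c] [Fintype a]
  [DecidableEq a] [DecidableEq b] [DecidableEq c]
  [Nonempty a] [Nonempty b] [Nonempty c]

/-- A common-cause block form for a channel operator `ρ_{BC|A}`: a unitary decomposition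
of the input space as a direct sum of tensor products, with the channel factorizing
blockwise into a `B`-channel and a `C`-channel. -/
structure CommonCauseBlockForm (ρ : Matrix ((b × c) × a) ((b × c) × a) ℂ) where
  ι : Type
  [fintι : Fintype ι]
  [deceqι : DecidableEq ι]
  m : ι → ℕ
  n : ι → ℕ
  card_eq : ∑ i : ι, m i * n i = Fintype.card a
  V : Matrix (Σ i : ι, Fin (m i) × Fin (n i)) a ℂ
  hV : IsUnitaryMat V
  ρB : ∀ i : ι, Matrix (b × Fin (m i)) (b × Fin (m i)) ℂ
  ρC : ∀ i : ι, Matrix (c × Fin (n i)) (c × Fin (n i)) ℂ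
  hρB : ∀ i, (ρB i).PosSemidef ∧ ptrace₁ (ρB i) = 1
  hρC : ∀ i, (ρC i).PosSemidef ∧ ptrace₁ (ρC i) = 1
  offdiag : ∀ (β β' : b) (γ γ' : c) (s t : Σ i : ι, Fin (m i) × Fin (n i)), s.1 ≠ t.1 →
    conjOnA ρ V ((β, γ), s) ((β', γ'), t) = 0
  diag : ∀ (i : ι) (μ μ' : Fin (m i)) (ν ν' : Fin (n i)) (β β' : b) (γ γ' : c),
    conjOnA ρ V ((β, γ), ⟨i, (μ, ν)⟩) ((β', γ'), ⟨i, (μ', ν')⟩) =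
      ρB i (β, μ) (β', μ') * ρC i (γ, ν) (γ', ν')

theorem eq_at_half_of_strip_bound {h : ℂ → ℂ} {t : ℝ} (hd : Differentiable ℂ h)
    (hB : ∃ C, ∀ z : ℂ, 0 ≤ z.re → z.re ≤ 1 / 2 → ‖h z‖ ≤ C)
    (h0 : h 0 = t) (h0' : HasDerivAt h 0 0)
    (hleft : ∀ z : ℂ, z.re = 0 → ‖h z‖ ≤ t) (hright : ∀ z : ℂ, z.re = 1 / 2 → ‖h z‖ ≤ t) :
    h (1 / 2) = t := by
  have hle : ∀ z : ℂ, 0 ≤ z.re → z.re ≤ 1 / 2 → ‖h z‖ ≤ t := by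
    intro z hz0 hz1
    obtain ⟨C, hC⟩ := hB
    refine PhragmenLindelof.vertical_strip (a := 0) (b := 1 / 2) hd.diffContOnCl
      ⟨0, by positivity, 0, ?_⟩ hleft hright hz0 hz1
    refine Asymptotics.IsBigO.of_bound C ?_
    refine Filter.Eventually.filter_mono inf_le_right ?_
    refine Filter.eventually_principal.2 fun w hw => ?_
    simpa using hC w hw.1.le hw.2.le
  have hre : ∀ z : ℂ, 0 ≤ z.re → z.re ≤ 1 / 2 → 0 ≤ (t - h z).re := by
    intro z hz0 hz1
    have := (Complex.re_le_norm (h z)).trans (hle z hz0 hz1)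
    simpa using this
  have hgd : Differentiable ℂ fun z => t - h z := (differentiable_const _).sub hd
  have hg0' : HasDerivAt (fun z => t - h z) 0 0 := by simpa using h0'.const_sub (t : ℂ)
  by_cases hev : ∀ᶠ z in nhds (0 : ℂ), t - h z = 0
  · have := AnalyticOnNhd.eq_of_eventuallyEq (f := fun z => t - h z) (g := fun _ => 0)
      (hgd.differentiableOn.analyticOnNhd isOpen_univ) analyticOnNhd_const hev
    exact (sub_eq_zero.1 (congrFun this (1 / 2))).symm
  exfalso
  obtain ⟨n, q, hq, hq0, hqe⟩ :=
    (hgd.analyticAt 0).exists_eventuallyEq_pow_smul_nonzero_iff.2 hev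
  simp only [sub_zero, smul_eq_mul] at hqe
  have hn : 2 ≤ n := by
    by_contra! hn
    interval_cases n
    · have := hqe.self_of_nhds
      rw [h0] at this
      simp at this
      exact hq0 this.symm
    · have h1 : HasDerivAt (fun z => z ^ 1 * q z) (q 0) 0 := by
        have := (hasDerivAt_id (0 : ℂ)).fun_mul hq.differentiableAt.hasDerivAt
        simpa using this
      exact hq0 ((h1.congr_of_eventuallyEq hqe).unique hg0')
  set w : ℂ := -star (q 0) with hw
  have hw0 : w ≠ 0 := by simpa [hw] using hq0
  set u : ℂ := Complex.exp ((w.arg / n : ℝ) * Complex.I) with hu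
  have hn0 : (0 : ℝ) < n := by positivity
  have hun : u ^ n = Complex.exp (w.arg * Complex.I) := by
    rw [hu, ← Complex.exp_nat_mul]
    congr 1
    push_cast
    field_simp
  have hure : 0 ≤ u.re := by
    rw [hu, Complex.exp_ofReal_mul_I_re]
    have hn2 : (2 : ℝ) ≤ n := by exact_mod_cast hn
    have h1 := Complex.neg_pi_lt_arg w
    have h2 := Complex.arg_le_pi w
    apply Real.cos_nonneg_of_neg_pi_div_two_le_of_le
    · rw [le_div_iff₀ hn0]
      nlinarith [Real.pi_pos]
    · rw [div_le_iff₀ hn0]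
      nlinarith [Real.pi_pos]
  have hneg : (u ^ n * q 0).re < 0 := by
    have h1 : (‖w‖ : ℂ) * (u ^ n * q 0) = -(Complex.normSq (q 0) : ℂ) := by
      rw [hun, ← mul_assoc, Complex.norm_mul_exp_arg_mul_I, hw, neg_mul, Complex.normSq_eq_conj_mul_self]
      rfl
    have h2 := congrArg Complex.re h1
    rw [Complex.re_ofReal_mul, Complex.neg_re, Complex.ofReal_re] at h2
    have h3 := Complex.normSq_pos.2 hq0
    have h4 := norm_pos_iff.2 hw0
    by_contra! h5
    nlinarith [mul_nonneg h4.le h5]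
  have hlim : Filter.Tendsto (fun r : ℝ => (r : ℂ) * u) (nhdsWithin 0 (Set.Ioi 0)) (nhds 0) := by
    have : Continuous fun r : ℝ => (r : ℂ) * u := by fun_prop
    simpa using (this.tendsto 0).mono_left nhdsWithin_le_nhds
  have hlim2 : Filter.Tendsto (fun r : ℝ => (u ^ n * q (r * u)).re) (nhdsWithin 0 (Set.Ioi 0))
      (nhds (u ^ n * q 0).re) :=
    (Complex.continuous_re.tendsto _).comp
      ((hq.continuousAt.tendsto.comp hlim).const_mul (u ^ n))
  have hsmall : ∀ᶠ r : ℝ in nhdsWithin 0 (Set.Ioi 0), ((r : ℂ) * u).re < 1 / 2 := by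
    have := (Complex.continuous_re.tendsto _).comp hlim
    exact this.eventually_lt_const (by simp)
  obtain ⟨r, hr1, hr2, hr3, hr4⟩ := ((hlim.eventually hqe).and
    ((hlim2.eventually_lt_const hneg).and (hsmall.and self_mem_nhdsWithin))).exists
  have hr4' : 0 < r := hr4
  have h1 := hre (r * u) (by rw [Complex.re_ofReal_mul]; positivity) hr3.le
  rw [hr1] at h1
  have h2 : ((r : ℂ) * u) ^ n * q (r * u) = ((r ^ n : ℝ) : ℂ) * (u ^ n * q (r * u)) := by
    push_cast; ring
  rw [h2, Complex.re_ofReal_mul] at h1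
  have h3 : 0 < r ^ n := by positivity
  nlinarith [mul_pos h3 (neg_pos.2 hr2)]

/-- The squared Hilbert–Schmidt norm. -/
noncomputable def hsNormSq {n : Type*} [Fintype n] (A : Matrix n n ℂ) : ℝ := (trace (Aᴴ * A)).re

section
variable {n : Type*} [Fintype n]

theorem hsNormSq_nonneg (A : Matrix n n ℂ) : 0 ≤ hsNormSq A :=
  (Complex.le_def.1 (posSemidef_conjTranspose_mul_self A).trace_nonneg).1

theorem trace_conjTranspose_mul_self_eq_hsNormSq (A : Matrix n n ℂ) :
    trace (Aᴴ * A) = hsNormSq A :=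
  Complex.ext rfl (by
    simpa using (Complex.le_def.1 (posSemidef_conjTranspose_mul_self A).trace_nonneg).2.symm)

theorem eq_zero_of_hsNormSq_eq_zero {A : Matrix n n ℂ} (h : hsNormSq A = 0) : A = 0 := by
  rw [← trace_conjTranspose_mul_self_eq_zero_iff, trace_conjTranspose_mul_self_eq_hsNormSq, h]
  simp

theorem hsNormSq_conjTranspose (A : Matrix n n ℂ) : hsNormSq Aᴴ = hsNormSq A := by
  rw [hsNormSq, hsNormSq, conjTranspose_conjTranspose, trace_mul_comm]

theorem hsNormSq_sub (A B : Matrix n n ℂ) :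
    hsNormSq (A - B) = hsNormSq A + hsNormSq B - 2 * (trace (Aᴴ * B)).re := by
  have h : (trace (Bᴴ * A)).re = (trace (Aᴴ * B)).re := by
    rw [← conjTranspose_conjTranspose (Bᴴ * A), trace_conjTranspose, conjTranspose_mul,
      conjTranspose_conjTranspose]
    simp
  simp only [hsNormSq, conjTranspose_sub, sub_mul, mul_sub, trace_sub, Complex.sub_re, h]
  ring

theorem hsNormSq_smul (c : ℂ) (A : Matrix n n ℂ) : hsNormSq (c • A) = ‖c‖ ^ 2 * hsNormSq A := by
  rw [hsNormSq, conjTranspose_smul, smul_mul_smul_comm, trace_smul, smul_eq_mul, hsNormSq,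
    ← Complex.normSq_eq_norm_sq, show star c * c = (Complex.normSq c : ℂ) from
      (Complex.normSq_eq_conj_mul_self).symm, Complex.re_ofReal_mul]

theorem norm_trace_conjTranspose_mul_le {A B : Matrix n n ℂ} {t : ℝ} (hA : hsNormSq A ≤ t)
    (hB : hsNormSq B ≤ t) : ‖trace (Aᴴ * B)‖ ≤ t := by
  set w := trace (Aᴴ * B) with hw
  rcases eq_or_ne w 0 with h0 | h0
  · rw [h0, norm_zero]
    exact (hsNormSq_nonneg A).trans hA
  · have h1 := hsNormSq_nonneg (A - ((star w / ‖w‖) • B))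
    have hn : (‖w‖ : ℂ) ≠ 0 := by simpa using h0
    have hn' : ‖w‖ ≠ 0 := by simpa using h0
    have h2 : trace (Aᴴ * ((star w / ‖w‖) • B)) = (‖w‖ : ℂ) := by
      rw [mul_smul_comm, trace_smul, ← hw, smul_eq_mul, div_mul_eq_mul_div,
        show star w * w = (Complex.normSq w : ℂ) from (Complex.normSq_eq_conj_mul_self).symm,
        Complex.normSq_eq_norm_sq]
      push_cast
      field_simp
    rw [hsNormSq_sub, hsNormSq_smul, h2, Complex.ofReal_re] at h1
    have h3 : ‖star w / (‖w‖ : ℂ)‖ = 1 := by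
      rw [norm_div, norm_star, Complex.norm_real, norm_norm, div_self hn']
    rw [h3] at h1
    linarith

variable [DecidableEq n] {ι : Type*}

theorem hsNormSq_map_mul_le (φ : (ι → ℂ) →⋆ₐ[ℂ] Matrix n n ℂ) {f : ι → ℂ} (hf : ∀ i, ‖f i‖ ≤ 1)
    (A : Matrix n n ℂ) : hsNormSq (φ f * A) ≤ hsNormSq A := by
  set g : ι → ℂ := fun i => (Real.sqrt (1 - ‖f i‖ ^ 2) : ℝ) with hg
  have h1 : star f * f + star g * g = 1 := by
    ext i
    have : 0 ≤ 1 - ‖f i‖ ^ 2 := by nlinarith [hf i, norm_nonneg (f i)]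
    simp only [Pi.add_apply, Pi.mul_apply, Pi.star_apply, hg, Pi.one_apply]
    rw [show star (f i) * f i = (Complex.normSq (f i) : ℂ) from
      (Complex.normSq_eq_conj_mul_self).symm, Complex.normSq_eq_norm_sq]
    simp only [RCLike.star_def, Complex.conj_ofReal]
    rw [← Complex.ofReal_mul, Real.mul_self_sqrt this]
    push_cast; ring
  have h2 : Aᴴ * A = (φ f * A)ᴴ * (φ f * A) + (φ g * A)ᴴ * (φ g * A) := by
    have h3 : (φ f)ᴴ * φ f + (φ g)ᴴ * φ g = 1 := by
      rw [← star_eq_conjTranspose, ← star_eq_conjTranspose, ← map_star, ← map_star, ← map_mul,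
        ← map_mul, ← map_add, h1, map_one]
    calc Aᴴ * A = Aᴴ * ((φ f)ᴴ * φ f + (φ g)ᴴ * φ g) * A := by rw [h3, mul_one]
      _ = _ := by simp only [conjTranspose_mul, mul_add, add_mul, mul_assoc]
  have h4 : hsNormSq A = hsNormSq (φ f * A) + hsNormSq (φ g * A) := by
    simp only [hsNormSq, h2, trace_add, Complex.add_re]
  linarith [hsNormSq_nonneg (φ g * A)]

theorem hsNormSq_mul_map_le (φ : (ι → ℂ) →⋆ₐ[ℂ] Matrix n n ℂ) {f : ι → ℂ} (hf : ∀ i, ‖f i‖ ≤ 1)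
    (A : Matrix n n ℂ) : hsNormSq (A * φ f) ≤ hsNormSq A := by
  rw [← hsNormSq_conjTranspose, ← hsNormSq_conjTranspose A, conjTranspose_mul,
    ← star_eq_conjTranspose (φ f), ← map_star]
  exact hsNormSq_map_mul_le φ (by simpa using hf) _
end

/-- The complex power `x ^ z` restricted to the support: `0 ^ z = 0` for every `z`. -/
noncomputable def suppPow (x : ℝ) (z : ℂ) : ℂ := if x = 0 then 0 else Complex.exp (Real.log x * z)

theorem suppPow_add (x : ℝ) (z w : ℂ) : suppPow x (z + w) = suppPow x z * suppPow x w := by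
  unfold suppPow
  split_ifs <;> simp [mul_add, Complex.exp_add]

theorem suppPow_one {x : ℝ} (hx : 0 ≤ x) : suppPow x 1 = x := by
  unfold suppPow
  split_ifs with h
  · simp [h]
  · rw [mul_one, ← Complex.ofReal_exp, Real.exp_log (lt_of_le_of_ne hx (Ne.symm h))]

theorem norm_suppPow_le_one (x : ℝ) {z : ℂ} (hz : z.re = 0) : ‖suppPow x z‖ ≤ 1 := by
  unfold suppPow
  split_ifs <;> simp [Complex.norm_exp, hz]

theorem norm_suppPow_le (x : ℝ) {z : ℂ} (hz : |z.re| ≤ 1 / 2) :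
    ‖suppPow x z‖ ≤ Real.exp |Real.log x| := by
  unfold suppPow
  split_ifs
  · simpa using Real.exp_nonneg _
  · rw [Complex.norm_exp, Complex.re_ofReal_mul]
    refine Real.exp_le_exp.2 ((le_abs_self _).trans ?_)
    rw [abs_mul]
    nlinarith [abs_nonneg (Real.log x)]

theorem star_suppPow (x : ℝ) (z : ℂ) : star (suppPow x z) = suppPow x (star z) := by
  unfold suppPow
  split_ifs
  · simp
  · rw [RCLike.star_def, ← Complex.exp_conj]; simp

theorem hasDerivAt_suppPow (x : ℝ) (z : ℂ) :
    HasDerivAt (suppPow x) (Real.log x * suppPow x z) z := by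
  by_cases h : x = 0
  · have : suppPow x = fun _ => 0 := by ext; simp [suppPow, h]
    rw [this]
    simpa using hasDerivAt_const z (0 : ℂ)
  · have : suppPow x = fun z => Complex.exp (Real.log x * z) := by ext; simp [suppPow, h]
    rw [this]
    simpa [mul_comm] using ((hasDerivAt_id z).const_mul (Real.log x : ℂ)).cexp

theorem log_mul_suppPow_zero (x : ℝ) : Real.log x * suppPow x 0 = Real.log x := by
  by_cases h : x = 0 <;> simp [suppPow, h]

open scoped Matrix.Norms.Frobenius in
theorem hasDerivAt_map_suppPow {n ι : Type*} [Fintype n] [DecidableEq n] [Fintype ι]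
    (φ : (ι → ℂ) →⋆ₐ[ℂ] Matrix n n ℂ) (x : ι → ℝ) (z : ℂ) :
    HasDerivAt (fun z => φ fun i => suppPow (x i) z)
      (φ fun i => Real.log (x i) * suppPow (x i) z) z := by
  have h : HasDerivAt (fun z => fun i => suppPow (x i) z)
      (fun i => Real.log (x i) * suppPow (x i) z) z :=
    hasDerivAt_pi.2 fun i => hasDerivAt_suppPow (x i) z
  exact (LinearMap.toContinuousLinearMap φ.toAlgHom.toLinearMap).hasFDerivAt.comp_hasDerivAt z h

theorem hsNormSq_map_mul_le_sq {n ι : Type*} [Fintype n] [DecidableEq n]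
    (φ : (ι → ℂ) →⋆ₐ[ℂ] Matrix n n ℂ) {f : ι → ℂ} {C : ℝ} (hC : 0 < C) (hf : ∀ i, ‖f i‖ ≤ C)
    (A : Matrix n n ℂ) : hsNormSq (φ f * A) ≤ C ^ 2 * hsNormSq A := by
  have h1 : f = (C : ℂ) • fun i => f i / C := by
    ext i
    have : (C : ℂ) ≠ 0 := by exact_mod_cast hC.ne'
    simp only [Pi.smul_apply, smul_eq_mul]
    field_simp
  rw [h1, map_smul, smul_mul_assoc, hsNormSq_smul, Complex.norm_real, Real.norm_of_nonneg hC.le]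
  refine mul_le_mul_of_nonneg_left (hsNormSq_map_mul_le φ (fun i => ?_) A) (by positivity)
  rw [norm_div, Complex.norm_real, Real.norm_of_nonneg hC.le]
  exact (div_le_one hC).2 (hf i)

theorem exists_norm_suppPow_le {ι : Type*} [Fintype ι] (x : ι → ℝ) :
    ∃ C, 0 < C ∧ ∀ z : ℂ, |z.re| ≤ 1 / 2 → ∀ i, ‖suppPow (x i) z‖ ≤ C := by
  refine ⟨1 + ∑ i, Real.exp |Real.log (x i)|, by positivity, fun z hz i => ?_⟩
  have := Finset.single_le_sum (f := fun i => Real.exp |Real.log (x i)|)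
      (fun _ _ => (Real.exp_pos _).le) (Finset.mem_univ i)
  linarith [norm_suppPow_le (x i) hz]

open scoped Matrix.Norms.Frobenius in
/-- Equality case of `Tr ρ log ρ ≥ Tr ρ log X + Tr ρ log Y` for positive semidefinite `ρ`, `X`, `Y`
with `Tr (Y X) = Tr ρ` and with the support of `ρ` contained in those of `X` and `Y`. The operators
are given by spectral calculi `χ`, `φ`, `ψ` together with their eigenvalues `r`, `x`, `y`. -/
theorem sqrt_mul_sqrt_eq_of_trace_log_eq {n ι₁ ι₂ ι₃ : Type*} [Fintype n] [DecidableEq n]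
    [Fintype ι₁] [Fintype ι₂] [Fintype ι₃]
    (φ : (ι₁ → ℂ) →⋆ₐ[ℂ] Matrix n n ℂ) (ψ : (ι₂ → ℂ) →⋆ₐ[ℂ] Matrix n n ℂ)
    (χ : (ι₃ → ℂ) →⋆ₐ[ℂ] Matrix n n ℂ) {x : ι₁ → ℝ} {y : ι₂ → ℝ} {r : ι₃ → ℝ}
    (hx : ∀ i, 0 ≤ x i) (hy : ∀ i, 0 ≤ y i) (hr : ∀ i, 0 ≤ r i)
    (hsx : (φ fun i => suppPow (x i) 0) * (χ fun i => (r i : ℂ)) = χ fun i => (r i : ℂ))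
    (hsy : (ψ fun i => suppPow (y i) 0) * (χ fun i => (r i : ℂ)) = χ fun i => (r i : ℂ))
    (htr : trace ((ψ fun i => (y i : ℂ)) * φ fun i => (x i : ℂ)) = trace (χ fun i => (r i : ℂ)))
    (hlog : trace ((χ fun i => (r i : ℂ)) * φ fun i => (Real.log (x i) : ℂ)) +
      trace ((χ fun i => (r i : ℂ)) * ψ fun i => (Real.log (y i) : ℂ)) =
      trace ((χ fun i => (r i : ℂ)) * χ fun i => (Real.log (r i) : ℂ))) :
    (ψ fun i => suppPow (y i) (1 / 2)) * (φ fun i => suppPow (x i) (1 / 2)) =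
      χ fun i => suppPow (r i) (1 / 2) := by
  set X : ℂ → Matrix n n ℂ := fun z => φ fun i => suppPow (x i) z with hX
  set Y : ℂ → Matrix n n ℂ := fun z => ψ fun i => suppPow (y i) z with hY
  set R : ℂ → Matrix n n ℂ := fun z => χ fun i => suppPow (r i) z with hR
  have Xadd : ∀ z w, X (z + w) = X z * X w := fun z w => by
    simp only [hX, suppPow_add, ← map_mul]; rfl
  have Yadd : ∀ z w, Y (z + w) = Y z * Y w := fun z w => by
    simp only [hY, suppPow_add, ← map_mul]; rfl
  have Radd : ∀ z w, R (z + w) = R z * R w := fun z w => by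
    simp only [hR, suppPow_add, ← map_mul]; rfl
  have Xstar : ∀ z, (X z)ᴴ = X (star z) := fun z => by
    rw [← star_eq_conjTranspose]
    simp only [hX, ← map_star, ← star_suppPow]; rfl
  have Ystar : ∀ z, (Y z)ᴴ = Y (star z) := fun z => by
    rw [← star_eq_conjTranspose]
    simp only [hY, ← map_star, ← star_suppPow]; rfl
  have Rstar : ∀ z, (R z)ᴴ = R (star z) := fun z => by
    rw [← star_eq_conjTranspose]
    simp only [hR, ← map_star, ← star_suppPow]; rfl
  have X1 : X 1 = φ fun i => (x i : ℂ) := by simp only [hX, suppPow_one (hx _)]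
  have Y1 : Y 1 = ψ fun i => (y i : ℂ) := by simp only [hY, suppPow_one (hy _)]
  have R1 : R 1 = χ fun i => (r i : ℂ) := by simp only [hR, suppPow_one (hr _)]
  have shalf : star (1 / 2 : ℂ) = 1 / 2 := by simp
  have dX : ∀ z, HasDerivAt X (φ fun i => Real.log (x i) * suppPow (x i) z) z :=
    hasDerivAt_map_suppPow φ x
  have dY : ∀ z, HasDerivAt Y (ψ fun i => Real.log (y i) * suppPow (y i) z) z :=
    hasDerivAt_map_suppPow ψ y
  have dR : ∀ z, HasDerivAt R (χ fun i => Real.log (r i) * suppPow (r i) z) z :=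
    hasDerivAt_map_suppPow χ r
  rw [← R1] at hlog hsx hsy htr
  rw [← X1, ← Y1] at htr
  change X 0 * R 1 = R 1 at hsx
  change Y 0 * R 1 = R 1 at hsy
  change Y (1 / 2) * X (1 / 2) = R (1 / 2)
  have XR : ∀ w, X 0 * R w = R w := fun w => by
    rw [show w = 1 + (w - 1) by ring, Radd, ← mul_assoc, hsx]
  have YR : ∀ w, Y 0 * R w = R w := fun w => by
    rw [show w = 1 + (w - 1) by ring, Radd, ← mul_assoc, hsy]
  have RY : R (1 / 2) * Y 0 = R (1 / 2) := by
    have := congrArg conjTranspose (YR (1 / 2))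
    rwa [conjTranspose_mul, Rstar, Ystar, shalf, star_zero] at this
  have Rhh : R (1 / 2) * R (1 / 2) = R 1 := by rw [← Radd]; norm_num
  set t : ℝ := hsNormSq (R (1 / 2)) with ht
  have htR : trace (R 1) = t := by
    rw [ht, ← trace_conjTranspose_mul_self_eq_hsNormSq, Rstar, shalf, Rhh]
  have htYX : hsNormSq (Y (1 / 2) * X (1 / 2)) = t := by
    have h1 : trace ((Y (1 / 2) * X (1 / 2))ᴴ * (Y (1 / 2) * X (1 / 2))) = t := by
      rw [conjTranspose_mul, Ystar, Xstar, shalf, ← htR, ← htr, mul_assoc, trace_mul_comm,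
        ← mul_assoc (Y _), ← Yadd, mul_assoc, ← Xadd]
      norm_num
    rw [hsNormSq, h1, Complex.ofReal_re]
  set h : ℂ → ℂ := fun z => trace ((R (1 / 2))ᴴ * (Y z * X z * R (1 / 2 - z))) with hh
  have dh : ∀ z, HasDerivAt h (trace ((R (1 / 2))ᴴ *
      (((ψ fun i => Real.log (y i) * suppPow (y i) z) * X z +
        Y z * (φ fun i => Real.log (x i) * suppPow (x i) z)) * R (1 / 2 - z) +
        Y z * X z * -(χ fun i => Real.log (r i) * suppPow (r i) (1 / 2 - z))))) z := fun z => by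
    have h1 : HasDerivAt (fun z => R (1 / 2 - z))
        (-(χ fun i => Real.log (r i) * suppPow (r i) (1 / 2 - z))) z := by
      exact (dR (1 / 2 - z)).comp_const_sub (1 / 2) z
    have h2 := (((dY z).fun_mul (dX z)).fun_mul h1).const_mul ((R (1 / 2))ᴴ)
    exact (LinearMap.toContinuousLinearMap (traceLinearMap n ℂ ℂ)).hasFDerivAt.comp_hasDerivAt z h2
  have key : h (1 / 2) = t := by
    refine eq_at_half_of_strip_bound (fun z => (dh z).differentiableAt) ?_ ?_ ?_ ?_ ?_
    · obtain ⟨Cx, hCx, hCx'⟩ := exists_norm_suppPow_le x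
      obtain ⟨Cy, hCy, hCy'⟩ := exists_norm_suppPow_le y
      obtain ⟨Cr, hCr, hCr'⟩ := exists_norm_suppPow_le r
      refine ⟨max t (Cy ^ 2 * (Cx ^ 2 * (Cr ^ 2 * hsNormSq (1 : Matrix n n ℂ)))),
        fun z hz0 hz1 => norm_trace_conjTranspose_mul_le (le_max_left _ _) (le_max_of_le_right ?_)⟩
      have hz : |z.re| ≤ 1 / 2 := abs_le.2 ⟨by linarith, hz1⟩
      have hz' : |((1 / 2 - z : ℂ)).re| ≤ 1 / 2 := by
        have : ((1 / 2 - z : ℂ)).re = 1 / 2 - z.re := by simp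
        rw [this]
        exact abs_le.2 ⟨by linarith, by linarith⟩
      rw [mul_assoc, ← mul_one (R _)]
      refine (hsNormSq_map_mul_le_sq ψ hCy (hCy' z hz) _).trans ?_
      gcongr
      refine (hsNormSq_map_mul_le_sq φ hCx (hCx' z hz) _).trans ?_
      gcongr
      exact hsNormSq_map_mul_le_sq χ hCr (hCr' _ hz') _
    · simp only [hh]
      rw [sub_zero, mul_assoc, XR, YR, Rstar, shalf, Rhh, htR]
    · refine (dh 0).congr_deriv ?_
      simp only [log_mul_suppPow_zero, sub_zero]
      have h1 : (χ fun i => Real.log (r i) * suppPow (r i) (1 / 2)) =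
          R (1 / 2) * χ fun i => (Real.log (r i) : ℂ) := by
        simp only [hR, ← map_mul]
        congr 1
        ext i
        simp [mul_comm]
      have cyc : ∀ M, trace (R (1 / 2) * (M * R (1 / 2))) = trace (R 1 * M) := fun M => by
        rw [trace_mul_comm, mul_assoc, Rhh, trace_mul_comm]
      rw [h1, mul_neg, mul_assoc (Y 0), ← mul_assoc (X 0), XR, ← mul_assoc (Y 0), YR, add_mul,
        mul_assoc _ (X 0), XR, Rstar, shalf, mul_add, mul_add, mul_neg, ← mul_assoc _ (R _), Rhh,
        mul_assoc (Y 0), ← mul_assoc _ (Y 0), RY, trace_add, trace_add, trace_neg, cyc, cyc,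
        ← hlog]
      ring
    · intro z hz
      refine norm_trace_conjTranspose_mul_le le_rfl ?_
      rw [mul_assoc]
      refine (hsNormSq_map_mul_le ψ (fun i => norm_suppPow_le_one _ hz) _).trans ?_
      refine (hsNormSq_map_mul_le φ (fun i => norm_suppPow_le_one _ hz) _).trans ?_
      rw [sub_eq_add_neg, Radd]
      exact hsNormSq_mul_map_le χ (fun i => norm_suppPow_le_one _ (by simp [hz])) _
    · intro z hz
      refine norm_trace_conjTranspose_mul_le le_rfl ?_
      have hz' : (z - 1 / 2).re = 0 := by simp [hz]
      refine (hsNormSq_mul_map_le χ (fun i => norm_suppPow_le_one _ (by simp [hz])) _).trans ?_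
      have hYz : Y z = Y (z - 1 / 2) * Y (1 / 2) := by rw [← Yadd, sub_add_cancel]
      have hXz : X z = X (1 / 2) * X (z - 1 / 2) := by rw [← Xadd, add_sub_cancel]
      rw [hYz, hXz, mul_assoc, ← mul_assoc (Y (1 / 2)), ← htYX]
      refine (hsNormSq_map_mul_le ψ (fun i => norm_suppPow_le_one _ hz') _).trans ?_
      exact hsNormSq_mul_map_le φ (fun i => norm_suppPow_le_one _ hz') _
  have hR0 : R (1 / 2 - 1 / 2) = R 0 := by rw [sub_self]
  have key2 : trace ((R (1 / 2))ᴴ * (Y (1 / 2) * X (1 / 2))) = t := by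
    rw [← key]
    simp only [hh]
    rw [hR0, ← mul_assoc, ← mul_assoc, trace_mul_comm _ (R 0), Rstar, shalf, ← mul_assoc,
      ← mul_assoc, ← Radd, zero_add]
  have key3 := hsNormSq_sub (R (1 / 2)) (Y (1 / 2) * X (1 / 2))
  rw [key2, htYX, ← ht, Complex.ofReal_re] at key3
  exact (sub_eq_zero.1 (eq_zero_of_hsNormSq_eq_zero (by linarith))).symm

section
variable {n : Type*} [Fintype n] [DecidableEq n]

/-- The continuous functional calculus of a Hermitian matrix, as a function of its eigenvalue
labels. -/
def spectralCalculus {A : Matrix n n ℂ} (hA : A.IsHermitian) : (n → ℂ) →⋆ₐ[ℂ] Matrix n n ℂ where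
  toFun f := Unitary.conjStarAlgAut ℂ _ hA.eigenvectorUnitary (diagonal f)
  map_one' := by rw [Matrix.diagonal_one', map_one]
  map_mul' f g := by rw [← map_mul, diagonal_mul_diagonal']; rfl
  map_zero' := by rw [Matrix.diagonal_zero', map_zero]
  map_add' f g := by rw [← map_add, diagonal_add]; rfl
  commutes' r := by
    rw [← AlgHomClass.commutes (Unitary.conjStarAlgAut ℂ (Matrix n n ℂ) hA.eigenvectorUnitary) r,
      algebraMap_eq_diagonal]
  map_star' f := by rw [← map_star, star_eq_conjTranspose, diagonal_conjTranspose]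

theorem spectralCalculus_apply {A : Matrix n n ℂ} (hA : A.IsHermitian) (f : n → ℂ) :
    spectralCalculus hA f =
      (hA.eigenvectorUnitary : Matrix n n ℂ) * diagonal f *
        star (hA.eigenvectorUnitary : Matrix n n ℂ) := rfl

theorem spectralCalculus_eigenvalues {A : Matrix n n ℂ} (hA : A.IsHermitian) :
    spectralCalculus hA (fun i => (hA.eigenvalues i : ℂ)) = A :=
  hA.spectral_theorem.symm

theorem trace_spectralCalculus {A : Matrix n n ℂ} (hA : A.IsHermitian) (f : n → ℂ) :
    trace (spectralCalculus hA f) = ∑ i, f i := by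
  rw [spectralCalculus_apply, trace_mul_comm, ← mul_assoc, Unitary.coe_star_mul_self, one_mul,
    trace_diagonal]

theorem charpoly_spectralCalculus {A : Matrix n n ℂ} (hA : A.IsHermitian) (f : n → ℂ) :
    (spectralCalculus hA f).charpoly = ∏ i, (Polynomial.X - Polynomial.C (f i)) := by
  rw [spectralCalculus_apply, charpoly_mul_comm, ← mul_assoc, Unitary.coe_star_mul_self, one_mul,
    charpoly_diagonal]

theorem vNEntropy_eq_of_charpoly_eq {A : Matrix n n ℂ} (hA : A.IsHermitian) (x : n → ℝ)
    (h : A.charpoly = ∏ i, (Polynomial.X - Polynomial.C (x i : ℂ))) :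
    vNEntropy A = -∑ i, x i * Real.log (x i) := by
  unfold vNEntropy
  rw [dif_pos hA]
  have hdec : ‹DecidableEq n› = Classical.decEq n := Subsingleton.elim _ _
  generalize Classical.decEq n = inst at hdec ⊢
  subst hdec
  have h1 : Multiset.map hA.eigenvalues Finset.univ.val =
      Multiset.map x Finset.univ.val := by
    have h2 := hA.roots_charpoly_eq_eigenvalues
    rw [h, show (∏ i, (Polynomial.X - Polynomial.C (x i : ℂ))) =
      ((Finset.univ.val.map fun i => (x i : ℂ)).map fun t => Polynomial.X - Polynomial.C t).prod by
        rw [Multiset.map_map]; rfl, Polynomial.roots_multiset_prod_X_sub_C] at h2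
    refine Multiset.map_injective Complex.ofReal_injective ?_
    rw [Multiset.map_map, Multiset.map_map]
    exact h2.symm
  have h3 := congrArg (fun s => (Multiset.map (fun t => t * Real.log t) s).sum) h1
  simp only [Multiset.map_map, Function.comp_apply] at h3
  exact congrArg Neg.neg h3

theorem vNEntropy_eq_neg_sum {A : Matrix n n ℂ} (hA : A.IsHermitian) :
    vNEntropy A = -∑ i, hA.eigenvalues i * Real.log (hA.eigenvalues i) :=
  vNEntropy_eq_of_charpoly_eq hA _ hA.charpoly_eq

theorem trace_mul_spectralCalculus_log {A : Matrix n n ℂ} (hA : A.IsHermitian) :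
    trace (A * spectralCalculus hA fun i => (Real.log (hA.eigenvalues i) : ℂ)) =
      -(vNEntropy A : ℂ) := by
  have h := congrArg (· * spectralCalculus hA fun i => (Real.log (hA.eigenvalues i) : ℂ))
    (spectralCalculus_eigenvalues hA)
  rw [← h, ← map_mul, trace_spectralCalculus, vNEntropy_eq_neg_sum hA]
  push_cast
  simp

theorem vNEntropy_smul {A : Matrix n n ℂ} (hA : A.PosSemidef) {d : ℝ} (hd : 0 < d) :
    vNEntropy ((1 / (d : ℂ)) • A) = (vNEntropy A + Real.log d * (trace A).re) / d := by
  have htr : (trace A).re = ∑ i, hA.1.eigenvalues i := by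
    rw [hA.1.trace_eq_sum_eigenvalues]
    simp
  have h1 : (1 / (d : ℂ)) • A =
      spectralCalculus hA.1 fun i => ((hA.1.eigenvalues i / d : ℝ) : ℂ) := by
    rw [← congrArg ((1 / (d : ℂ)) • ·) (spectralCalculus_eigenvalues hA.1), ← map_smul]
    congr 1
    ext i
    simp [div_eq_inv_mul]
  have h2 : ((1 / (d : ℂ)) • A).IsHermitian := by
    have := hA.1
    unfold IsHermitian at *
    rw [conjTranspose_smul, this]
    simp
  rw [vNEntropy_eq_of_charpoly_eq h2 (fun i => hA.1.eigenvalues i / d)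
    (by rw [h1, charpoly_spectralCalculus]), vNEntropy_eq_neg_sum hA.1,
    htr, Finset.mul_sum,
    neg_add_eq_sub, ← Finset.sum_sub_distrib, Finset.sum_div, ← Finset.sum_neg_distrib]
  refine Finset.sum_congr rfl fun i _ => ?_
  rcases eq_or_ne (hA.1.eigenvalues i) 0 with h | h
  · simp [h]
  · rw [Real.log_div h hd.ne']
    ring

theorem vNEntropy_one : vNEntropy (1 : Matrix n n ℂ) = 0 := by
  rw [vNEntropy_eq_of_charpoly_eq isHermitian_one (fun _ => 1)]
  · simp
  · rw [← diagonal_one, charpoly_diagonal]; simp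

theorem map_support_mul_eq_self {ι : Type*} (φ : (ι → ℂ) →⋆ₐ[ℂ] Matrix n n ℂ) (x : ι → ℝ)
    {ρ : Matrix n n ℂ} (hρ : ρ.PosSemidef)
    (h : trace ((φ fun i => 1 - suppPow (x i) 0) * ρ) = 0) :
    (φ fun i => suppPow (x i) 0) * ρ = ρ := by
  set Q := φ fun i => 1 - suppPow (x i) 0 with hQ
  have hQQ : Q * Q = Q := by
    rw [hQ, ← map_mul]
    congr 1
    ext i
    by_cases hi : x i = 0 <;> simp [suppPow, hi]
  have hQs : Qᴴ = Q := by
    rw [hQ, ← star_eq_conjTranspose, ← map_star]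
    congr 1
    ext i
    by_cases hi : x i = 0 <;> simp [suppPow, hi]
  have hQ1 : (φ fun i => suppPow (x i) 0) = 1 - Q := by
    rw [hQ, ← map_one φ, ← map_sub]
    congr 1
    ext i
    simp
  obtain ⟨S, rfl⟩ : ∃ S, ρ = Sᴴ * S := by
    refine ⟨spectralCalculus hρ.1 fun i => (Real.sqrt (hρ.1.eigenvalues i) : ℂ), ?_⟩
    rw [← star_eq_conjTranspose, ← map_star, ← map_mul]
    conv_lhs => rw [← spectralCalculus_eigenvalues hρ.1]
    congr 1
    ext i
    simp [← Complex.ofReal_mul, Real.mul_self_sqrt (hρ.eigenvalues_nonneg i)]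
  have hSQ : S * Q = 0 := by
    rw [← trace_conjTranspose_mul_self_eq_zero_iff, conjTranspose_mul, hQs, ← mul_assoc,
      trace_mul_comm, ← mul_assoc, ← mul_assoc, hQQ, mul_assoc, h]
  have hQS : Q * Sᴴ = 0 := by
    rw [← hQs, ← conjTranspose_mul, hSQ, conjTranspose_zero]
  rw [hQ1, sub_mul, one_mul, ← mul_assoc, hQS, zero_mul, sub_zero]
end

section
variable {b c a : Type*} [Fintype b] [Fintype c] [Fintype a]
  [DecidableEq a] [DecidableEq b] [DecidableEq c]

/-- `extB` as a homomorphism of ⋆-algebras. -/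
def extBHom : Matrix (b × a) (b × a) ℂ →⋆ₐ[ℂ] Matrix ((b × c) × a) ((b × c) × a) ℂ where
  toFun := extB
  map_one' := by
    ext ⟨⟨β, γ⟩, x⟩ ⟨⟨β', γ'⟩, x'⟩
    simp only [extB, of_apply, one_apply, Prod.mk.injEq]
    split_ifs <;> simp_all
  map_mul' M N := by
    ext ⟨⟨β, γ⟩, x⟩ ⟨⟨β', γ'⟩, x'⟩
    simp only [extB, of_apply, mul_apply, Fintype.sum_prod_type, Finset.sum_mul]
    refine Finset.sum_congr rfl fun β₁ _ => ?_
    rw [Finset.sum_comm]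
    refine Finset.sum_congr rfl fun x₁ _ => ?_
    rw [Finset.sum_eq_single γ']
    · simp
    · intro γ₁ _ h; simp [h]
    · simp
  map_zero' := by ext; simp [extB]
  map_add' M N := by
    ext p q
    simp only [extB, of_apply, Matrix.add_apply, add_mul]
  commutes' r := by
    ext ⟨⟨β, γ⟩, x⟩ ⟨⟨β', γ'⟩, x'⟩
    simp only [extB, of_apply, algebraMap_matrix_apply, Prod.mk.injEq]
    split_ifs <;> simp_all
  map_star' M := by
    ext ⟨⟨β, γ⟩, x⟩ ⟨⟨β', γ'⟩, x'⟩
    simp only [extB, of_apply, star_apply, star_mul', eq_comm (a := γ)]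
    split_ifs <;> simp

/-- `extC` as a homomorphism of ⋆-algebras. -/
def extCHom : Matrix (c × a) (c × a) ℂ →⋆ₐ[ℂ] Matrix ((b × c) × a) ((b × c) × a) ℂ where
  toFun := extC
  map_one' := by
    ext ⟨⟨β, γ⟩, x⟩ ⟨⟨β', γ'⟩, x'⟩
    simp only [extC, of_apply, one_apply, Prod.mk.injEq]
    split_ifs <;> simp_all
  map_mul' M N := by
    ext ⟨⟨β, γ⟩, x⟩ ⟨⟨β', γ'⟩, x'⟩
    simp only [extC, of_apply, mul_apply, Fintype.sum_prod_type, Finset.sum_mul]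
    rw [Finset.sum_eq_single β']
    · refine Finset.sum_congr rfl fun γ₁ _ => Finset.sum_congr rfl fun x₁ _ => ?_
      simp
    · intro β₁ _ h; simp [h]
    · simp
  map_zero' := by ext; simp [extC]
  map_add' M N := by
    ext p q
    simp only [extC, of_apply, Matrix.add_apply, add_mul]
  commutes' r := by
    ext ⟨⟨β, γ⟩, x⟩ ⟨⟨β', γ'⟩, x'⟩
    simp only [extC, of_apply, algebraMap_matrix_apply, Prod.mk.injEq]
    split_ifs <;> simp_all
  map_star' M := by
    ext ⟨⟨β, γ⟩, x⟩ ⟨⟨β', γ'⟩, x'⟩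
    simp only [extC, of_apply, star_apply, star_mul', eq_comm (a := β)]
    split_ifs <;> simp
end

theorem trace_mul_extB {b c a : Type*} [Fintype b] [Fintype c] [Fintype a] [DecidableEq c]
    (M : Matrix (b × a) (b × a) ℂ) (A : Matrix ((b × c) × a) ((b × c) × a) ℂ) :
    trace (A * extB M) = trace (margB A * M) := by
  simp only [trace, diag_apply, mul_apply, extB, margB, of_apply, Fintype.sum_prod_type,
    Finset.sum_mul]
  refine Finset.sum_congr rfl fun β _ => ?_
  rw [Finset.sum_comm]
  refine Finset.sum_congr rfl fun x _ => ?_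
  rw [Finset.sum_comm]
  refine Finset.sum_congr rfl fun β' _ => ?_
  symm
  rw [Finset.sum_comm]
  refine Finset.sum_congr rfl fun γ _ => ?_
  rw [Finset.sum_eq_single γ]
  · simp
  · intro γ' _ h; simp [h]
  · simp

theorem trace_mul_extC {b c a : Type*} [Fintype b] [Fintype c] [Fintype a] [DecidableEq b]
    (M : Matrix (c × a) (c × a) ℂ) (A : Matrix ((b × c) × a) ((b × c) × a) ℂ) :
    trace (A * extC M) = trace (margC A * M) := by
  simp only [trace, diag_apply, mul_apply, extC, margC, of_apply, Fintype.sum_prod_type,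
    Finset.sum_mul]
  rw [Finset.sum_comm]
  refine Finset.sum_congr rfl fun γ _ => ?_
  rw [Finset.sum_comm]
  refine Finset.sum_congr rfl fun x _ => ?_
  have h : ∀ β, (∑ β', ∑ γ', ∑ x', A ((β, γ), x) ((β', γ'), x') *
      (M (γ', x') (γ, x) * if β' = β then 1 else 0)) =
      ∑ γ', ∑ x', A ((β, γ), x) ((β, γ'), x') * M (γ', x') (γ, x) := by
    intro β
    rw [Finset.sum_eq_single β]
    · simp
    · intro β' _ h; simp [h]
    · simp
  rw [Finset.sum_congr rfl fun β _ => h β, Finset.sum_comm]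
  exact Finset.sum_congr rfl fun γ' _ => Finset.sum_comm

theorem margB_posSemidef {b c a : Type*} [Fintype c]
    {ρ : Matrix ((b × c) × a) ((b × c) × a) ℂ} (hρ : ρ.PosSemidef) :
    (margB ρ).PosSemidef := by
  have : margB ρ = ∑ γ, ρ.submatrix (fun p : b × a => ((p.1, γ), p.2)) fun p => ((p.1, γ), p.2) := by
    ext
    simp [margB, Matrix.sum_apply]
  rw [this]
  exact posSemidef_sum _ fun γ _ => hρ.submatrix _

theorem margC_posSemidef {b c a : Type*} [Fintype b]
    {ρ : Matrix ((b × c) × a) ((b × c) × a) ℂ} (hρ : ρ.PosSemidef) :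
    (margC ρ).PosSemidef := by
  have : margC ρ = ∑ β, ρ.submatrix (fun p : c × a => ((β, p.1), p.2)) fun p => ((β, p.1), p.2) := by
    ext
    simp [margC, Matrix.sum_apply]
  rw [this]
  exact posSemidef_sum _ fun γ _ => hρ.submatrix _

theorem ptrace₁_margB {b c a : Type*} [Fintype b] [Fintype c]
    (ρ : Matrix ((b × c) × a) ((b × c) × a) ℂ) :
    ptrace₁ (margB ρ) = ptrace₁ ρ := by
  ext
  simp [ptrace₁, margB, Fintype.sum_prod_type]

theorem ptrace₁_margC {b c a : Type*} [Fintype b] [Fintype c]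
    (ρ : Matrix ((b × c) × a) ((b × c) × a) ℂ) :
    ptrace₁ (margC ρ) = ptrace₁ ρ := by
  ext
  simp [ptrace₁, margC, Fintype.sum_prod_type, Finset.sum_comm (γ := b)]

theorem trace_ptrace₁ {b a : Type*} [Fintype b] [Fintype a] (M : Matrix (b × a) (b × a) ℂ) :
    trace (ptrace₁ M) = trace M := by
  simp [ptrace₁, trace, Fintype.sum_prod_type, Finset.sum_comm (γ := a)]

theorem margC_extB {b c a : Type*} [Fintype b] [DecidableEq a] [DecidableEq c]
    {M : Matrix (b × a) (b × a) ℂ} (hM : ptrace₁ M = 1) :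
    margC (extB M : Matrix ((b × c) × a) ((b × c) × a) ℂ) = 1 := by
  ext ⟨γ, x⟩ ⟨γ', x'⟩
  have h := congrFun (congrFun hM x) x'
  simp only [ptrace₁, of_apply, one_apply] at h
  change ∑ β, M (β, x) (β, x') * (if γ = γ' then 1 else 0) = _
  rw [← Finset.sum_mul, h]
  simp only [one_apply, Prod.mk.injEq]
  split_ifs <;> simp_all

theorem trace_spectralCalculus_support {n : Type*} [Fintype n] [DecidableEq n] {A : Matrix n n ℂ}
    (hA : A.IsHermitian) :
    trace (A * spectralCalculus hA fun i => 1 - suppPow (hA.eigenvalues i) 0) = 0 := by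
  rw [← congrArg (· * spectralCalculus hA fun i => 1 - suppPow (hA.eigenvalues i) 0)
    (spectralCalculus_eigenvalues hA), ← map_mul, trace_spectralCalculus]
  refine Finset.sum_eq_zero fun i _ => ?_
  by_cases hi : hA.eigenvalues i = 0 <;> simp [suppPow, hi]

theorem spectralCalculus_suppPow_half {ι n : Type*} [Fintype n] [DecidableEq n]
    (φ : (ι → ℂ) →⋆ₐ[ℂ] Matrix n n ℂ) {x : ι → ℝ} (hx : ∀ i, 0 ≤ x i) :
    (φ fun i => suppPow (x i) (1 / 2)) * (φ fun i => suppPow (x i) (1 / 2)) =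
      φ fun i => (x i : ℂ) := by
  rw [← map_mul]
  congr 1
  ext i
  rw [Pi.mul_apply, ← suppPow_add, add_halves, suppPow_one (hx i)]

theorem isHermitian_suppPow_half {ι n : Type*} [Fintype n] [DecidableEq n]
    (φ : (ι → ℂ) →⋆ₐ[ℂ] Matrix n n ℂ) (x : ι → ℝ) :
    (φ fun i => suppPow (x i) (1 / 2))ᴴ = φ fun i => suppPow (x i) (1 / 2) := by
  rw [← star_eq_conjTranspose, ← map_star]
  congr 1
  ext i
  rw [Pi.star_apply, star_suppPow]
  simp

theorem mul_eq_of_sqrt_mul_sqrt_eq {n : Type*} [Fintype n] {P Q R X Y Z : Matrix n n ℂ}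
    (hP : Pᴴ = P) (hQ : Qᴴ = Q) (hR : Rᴴ = R) (hX : P * P = X) (hY : Q * Q = Y) (hZ : R * R = Z)
    (h : Q * P = R) : X * Y = Z ∧ Y * X = Z := by
  have h' : P * Q = R := by
    rw [← hR, ← h, conjTranspose_mul, hP, hQ]
  rw [← hX, ← hY, ← hZ]
  constructor
  · calc P * P * (Q * Q) = P * (P * Q) * Q := by simp only [mul_assoc]
      _ = P * (Q * P) * Q := by rw [h', h]
      _ = (P * Q) * (P * Q) := by simp only [mul_assoc]
      _ = R * R := by rw [h']
  · calc Q * Q * (P * P) = Q * (Q * P) * P := by simp only [mul_assoc]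
      _ = Q * (P * Q) * P := by rw [h', h]
      _ = (Q * P) * (Q * P) := by simp only [mul_assoc]
      _ = R * R := by rw [h]

section
variable {b c a : Type*} [Fintype b] [Fintype c] [Fintype a]
  [DecidableEq a] [DecidableEq b] [DecidableEq c] [Nonempty a]

theorem vNEntropy_margB_add_margC_of_qcmiBCA_eq_zero {ρ : Matrix ((b × c) × a) ((b × c) × a) ℂ}
    (hρ : IsCJChannel ρ) (hcmi : qcmiBCA ((1 / (Fintype.card a : ℂ)) • ρ) = 0) :
    vNEntropy (margB ρ) + vNEntropy (margC ρ) = vNEntropy ρ := by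
  have hd : (0 : ℝ) < Fintype.card a := Nat.cast_pos.2 Fintype.card_pos
  have hB : margB ((1 / (Fintype.card a : ℂ)) • ρ) =
      (1 / ((Fintype.card a : ℝ) : ℂ)) • margB ρ := by
    ext
    simp [margB, Finset.mul_sum]
  have hC : margC ((1 / (Fintype.card a : ℂ)) • ρ) =
      (1 / ((Fintype.card a : ℝ) : ℂ)) • margC ρ := by
    ext
    simp [margC, Finset.mul_sum]
  have hA : ptrace₁ ((1 / (Fintype.card a : ℂ)) • ρ) =
      (1 / ((Fintype.card a : ℝ) : ℂ)) • (1 : Matrix a a ℂ) := by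
    rw [← hρ.2]
    ext
    simp [ptrace₁, Finset.mul_sum]
  have hR : (1 / (Fintype.card a : ℂ)) • ρ = (1 / ((Fintype.card a : ℝ) : ℂ)) • ρ := by simp
  rw [qcmiBCA, hB, hC, hA, hR, vNEntropy_smul (margB_posSemidef hρ.1) hd,
    vNEntropy_smul (margC_posSemidef hρ.1) hd, vNEntropy_smul hρ.1 hd,
    vNEntropy_smul PosSemidef.one hd, vNEntropy_one, ← trace_ptrace₁ (margB ρ),
    ← trace_ptrace₁ (margC ρ), ← trace_ptrace₁ ρ, ptrace₁_margB, ptrace₁_margC, hρ.2] at hcmi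
  field_simp at hcmi
  linarith

/-- A channel operator with vanishing conditional mutual information is the product of its
commuting marginals. -/
theorem extB_mul_extC_of_qcmiBCA_eq_zero {ρ : Matrix ((b × c) × a) ((b × c) × a) ℂ}
    (hρ : IsCJChannel ρ) (hcmi : qcmiBCA ((1 / (Fintype.card a : ℂ)) • ρ) = 0) :
    extB (margB ρ) * extC (margC ρ) = ρ ∧ extC (margC ρ) * extB (margB ρ) = ρ := by
  have hent := vNEntropy_margB_add_margC_of_qcmiBCA_eq_zero hρ hcmi
  have hB := margB_posSemidef hρ.1
  have hC := margC_posSemidef hρ.1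
  have hX : extBHom (spectralCalculus hB.1 fun i => (hB.1.eigenvalues i : ℂ)) =
      (extB (margB ρ) : Matrix ((b × c) × a) ((b × c) × a) ℂ) :=
    congrArg extB (spectralCalculus_eigenvalues hB.1)
  have hY : extCHom (spectralCalculus hC.1 fun i => (hC.1.eigenvalues i : ℂ)) =
      (extC (margC ρ) : Matrix ((b × c) × a) ((b × c) × a) ℂ) :=
    congrArg extC (spectralCalculus_eigenvalues hC.1)
  have key := sqrt_mul_sqrt_eq_of_trace_log_eq
    ((extBHom (b := b) (c := c) (a := a)).comp (spectralCalculus hB.1))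
    ((extCHom (b := b) (c := c) (a := a)).comp (spectralCalculus hC.1)) (spectralCalculus hρ.1.1)
    hB.eigenvalues_nonneg hC.eigenvalues_nonneg hρ.1.eigenvalues_nonneg
    (by
      rw [spectralCalculus_eigenvalues]
      refine map_support_mul_eq_self _ _ hρ.1 ?_
      rw [trace_mul_comm]
      exact (trace_mul_extB _ _).trans (trace_spectralCalculus_support hB.1))
    (by
      rw [spectralCalculus_eigenvalues]
      refine map_support_mul_eq_self _ _ hρ.1 ?_
      rw [trace_mul_comm]
      exact (trace_mul_extC _ _).trans (trace_spectralCalculus_support hC.1))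
    (by
      rw [spectralCalculus_eigenvalues, StarAlgHom.comp_apply, StarAlgHom.comp_apply, hX, hY,
        trace_mul_comm, trace_mul_extC, margC_extB ((ptrace₁_margB ρ).trans hρ.2), one_mul,
        ← trace_ptrace₁, ptrace₁_margC, trace_ptrace₁])
    (by
      rw [spectralCalculus_eigenvalues, trace_mul_spectralCalculus_log, ← hent]
      refine (congrArg₂ (· + ·) ((trace_mul_extB _ _).trans (trace_mul_spectralCalculus_log hB.1))
        ((trace_mul_extC _ _).trans (trace_mul_spectralCalculus_log hC.1))).trans ?_
      push_cast
      ring)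
  have hX2 := spectralCalculus_suppPow_half
    ((extBHom (b := b) (c := c) (a := a)).comp (spectralCalculus hB.1)) hB.eigenvalues_nonneg
  have hY2 := spectralCalculus_suppPow_half
    ((extCHom (b := b) (c := c) (a := a)).comp (spectralCalculus hC.1)) hC.eigenvalues_nonneg
  have hR2 := spectralCalculus_suppPow_half (spectralCalculus hρ.1.1) hρ.1.eigenvalues_nonneg
  have hXs := isHermitian_suppPow_half
    ((extBHom (b := b) (c := c) (a := a)).comp (spectralCalculus hB.1)) hB.1.eigenvalues
  have hYs := isHermitian_suppPow_half
    ((extCHom (b := b) (c := c) (a := a)).comp (spectralCalculus hC.1)) hC.1.eigenvalues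
  have hRs := isHermitian_suppPow_half (spectralCalculus hρ.1.1) hρ.1.1.eigenvalues
  replace hX2 := hX2.trans hX
  replace hY2 := hY2.trans hY
  rw [spectralCalculus_eigenvalues] at hR2
  exact mul_eq_of_sqrt_mul_sqrt_eq hXs hYs hRs hX2 hY2 hR2 key
end

section
variable {H κ ℓ : Type*} [NormedAddCommGroup H] [InnerProductSpace ℂ H]

/-- The submodule `W` is invariant under every member of the family `X`. -/
def IsInvariantUnder (X : κ → H →ₗ[ℂ] H) (W : Submodule ℂ H) : Prop :=
  ∀ k, ∀ v ∈ W, X k v ∈ W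

/-- The family `X` is closed under taking adjoints. -/
def IsAdjointClosed (X : κ → H →ₗ[ℂ] H) : Prop :=
  ∀ k, ∃ k', ∀ u v, inner ℂ (X k u) v = inner ℂ u (X k' v)

theorem IsInvariantUnder.orthogonal {X : κ → H →ₗ[ℂ] H} (hX : IsAdjointClosed X)
    {W : Submodule ℂ H} (hW : IsInvariantUnder X W) : IsInvariantUnder X Wᗮ := by
  intro k v hv
  obtain ⟨k', hk⟩ := hX k
  rw [Submodule.mem_orthogonal'] at hv ⊢
  intro u hu
  rw [hk]
  exact hv _ (hW k' u hu)

theorem IsInvariantUnder.inf {X : κ → H →ₗ[ℂ] H} {W W' : Submodule ℂ H}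
    (hW : IsInvariantUnder X W) (hW' : IsInvariantUnder X W') : IsInvariantUnder X (W ⊓ W') :=
  fun k v hv => ⟨hW k v hv.1, hW' k v hv.2⟩

/-- An orthonormal family of vectors indexed by a product on which `X` acts on the first index and
`Y` on the second one. -/
structure TensorBlock (X : κ → H →ₗ[ℂ] H) (Y : ℓ → H →ₗ[ℂ] H) where
  m : ℕ
  n : ℕ
  m_pos : 0 < m
  n_pos : 0 < n
  e : Fin m → Fin n → H
  orthonormal : Orthonormal ℂ fun p : Fin m × Fin n => e p.1 p.2
  actX : ∀ k, ∃ x : Fin m → Fin m → ℂ, ∀ μ ν, X k (e μ ν) = ∑ μ', x μ' μ • e μ' ν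
  actY : ∀ l, ∃ y : Fin n → Fin n → ℂ, ∀ μ ν, Y l (e μ ν) = ∑ ν', y ν' ν • e μ ν'

namespace TensorBlock
variable {X : κ → H →ₗ[ℂ] H} {Y : ℓ → H →ₗ[ℂ] H} (B : TensorBlock X Y)

/-- The space spanned by the vectors of a block. -/
def space : Submodule ℂ H := Submodule.span ℂ (Set.range fun p : Fin B.m × Fin B.n => B.e p.1 p.2)

theorem e_mem_space (μ : Fin B.m) (ν : Fin B.n) : B.e μ ν ∈ B.space :=
  Submodule.subset_span ⟨(μ, ν), rfl⟩

theorem space_le {W : Submodule ℂ H} : B.space ≤ W ↔ ∀ μ ν, B.e μ ν ∈ W := by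
  rw [space, Submodule.span_le]
  exact ⟨fun h μ ν => h ⟨(μ, ν), rfl⟩, by rintro h _ ⟨p, rfl⟩; exact h _ _⟩

theorem invariant_X : IsInvariantUnder X B.space := by
  intro k
  change B.space ≤ B.space.comap (X k)
  rw [space_le]
  intro μ ν
  obtain ⟨x, hx⟩ := B.actX k
  rw [Submodule.mem_comap, hx]
  exact Submodule.sum_mem _ fun μ' _ => Submodule.smul_mem _ _ (B.e_mem_space _ _)

theorem invariant_Y : IsInvariantUnder Y B.space := by
  intro l
  change B.space ≤ B.space.comap (Y l)
  rw [space_le]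
  intro μ ν
  obtain ⟨y, hy⟩ := B.actY l
  rw [Submodule.mem_comap, hy]
  exact Submodule.sum_mem _ fun μ' _ => Submodule.smul_mem _ _ (B.e_mem_space _ _)

theorem space_ne_bot : B.space ≠ ⊥ := by
  intro h
  have h1 := B.e_mem_space ⟨0, B.m_pos⟩ ⟨0, B.n_pos⟩
  rw [h, Submodule.mem_bot] at h1
  exact B.orthonormal.ne_zero (⟨0, B.m_pos⟩, ⟨0, B.n_pos⟩) h1

end TensorBlock

variable [FiniteDimensional ℂ H]

/-- Intertwiners out of an irreducible invariant subspace preserve inner products up to scaling. -/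
theorem exists_inner_intertwiner_eq {X : κ → H →ₗ[ℂ] H} (hX : IsAdjointClosed X)
    {K : Submodule ℂ H} (hK : IsInvariantUnder X K) (hK0 : K ≠ ⊥)
    (hmin : ∀ K' ≤ K, IsInvariantUnder X K' → K' ≠ ⊥ → K ≤ K') {S T : K →ₗ[ℂ] H}
    (hS : ∀ k (v : K), S ⟨X k v, hK k v v.2⟩ = X k (S v))
    (hT : ∀ k (v : K), T ⟨X k v, hK k v v.2⟩ = X k (T v)) :
    ∃ z : ℂ, ∀ u v, inner ℂ (S u) (T v) = z * inner ℂ u v := by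
  have : Nontrivial K := Submodule.nontrivial_iff_ne_bot.2 hK0
  set R : Module.End ℂ K := LinearMap.adjoint S ∘ₗ T with hR
  have hRi : ∀ u v, inner ℂ (S u) (T v) = inner ℂ u (R v) := fun u v => by
    rw [hR, LinearMap.comp_apply, LinearMap.adjoint_inner_right]
  obtain ⟨z, hz⟩ := Module.End.exists_eigenvalue R
  refine ⟨z, fun u v => ?_⟩
  have hcomm : ∀ k (v : K), R ⟨X k v, hK k v v.2⟩ = ⟨X k (R v), hK k _ (R v).2⟩ := by
    intro k v
    refine ext_inner_left ℂ fun u => ?_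
    obtain ⟨k', hk⟩ := hX k
    have hk' : ∀ u v, inner ℂ u (X k v) = inner ℂ (X k' u) v := fun u v => by
      rw [← inner_conj_symm, hk, inner_conj_symm]
    rw [← hRi, hT, hk', ← hS, hRi, Submodule.coe_inner, Submodule.coe_inner]
    exact (hk' _ _).symm
  have hle := hmin ((Module.End.eigenspace R z).map K.subtype) (Submodule.map_subtype_le _ _) (by
      rintro k _ ⟨w, hw, rfl⟩
      refine ⟨⟨X k w, hK k w w.2⟩, ?_, rfl⟩
      rw [SetLike.mem_coe, Module.End.mem_eigenspace_iff] at hw ⊢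
      rw [hcomm, hw]
      ext
      simp) (by
      rw [Ne, (Submodule.map_injective_of_injective K.injective_subtype).eq_iff'
        (Submodule.map_bot _)]
      exact hz)
  obtain ⟨w, hw, hwv⟩ := hle v.2
  obtain rfl : w = v := Subtype.ext hwv
  rw [SetLike.mem_coe, Module.End.mem_eigenspace_iff] at hw
  rw [hRi, hw, inner_smul_right]

theorem exists_tensorBlock_space_le {X : κ → H →ₗ[ℂ] H} {Y : ℓ → H →ₗ[ℂ] H}
    (hX : IsAdjointClosed X) (hXY : ∀ k l v, X k (Y l v) = Y l (X k v)) {W : Submodule ℂ H}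
    (hWX : IsInvariantUnder X W) (hWY : IsInvariantUnder Y W) (hW0 : W ≠ ⊥) :
    ∃ B : TensorBlock X Y, B.space ≤ W := by
  obtain ⟨K, ⟨hKW, hK, hK0⟩, hmin⟩ := exists_minimal_of_wellFoundedLT
    (fun K : Submodule ℂ H => K ≤ W ∧ IsInvariantUnder X K ∧ K ≠ ⊥) ⟨W, le_rfl, hWX, hW0⟩
  replace hmin : ∀ K' ≤ K, IsInvariantUnder X K' → K' ≠ ⊥ → K ≤ K' := fun K' h1 h2 h3 =>
    hmin ⟨h1.trans hKW, h2, h3⟩ h1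
  obtain ⟨I, hI⟩ : ∃ I : Submodule ℂ (K →ₗ[ℂ] H), ∀ T, T ∈ I ↔
      (∀ k (v : K), T ⟨X k v, hK k v v.2⟩ = X k (T v)) ∧ ∀ v, T v ∈ W := ⟨
    { carrier := {T | (∀ k (v : K), T ⟨X k v, hK k v v.2⟩ = X k (T v)) ∧ ∀ v, T v ∈ W}
      add_mem' := fun {S T} hS hT => ⟨fun k v => by simp [hS.1, hT.1],
        fun v => W.add_mem (hS.2 v) (hT.2 v)⟩
      zero_mem' := ⟨fun k v => by simp, fun v => W.zero_mem⟩
      smul_mem' := fun z T hT => ⟨fun k v => by simp [hT.1], fun v => W.smul_mem z (hT.2 v)⟩ }, fun T => Iff.rfl⟩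
  have hschur : ∀ S ∈ I, ∀ T ∈ I, ∃ z : ℂ, ∀ u v, inner ℂ (S u) (T v) = z * inner ℂ u v :=
    fun S hS T hT => exists_inner_intertwiner_eq hX hK hK0 hmin ((hI S).1 hS).1 ((hI T).1 hT).1
  have : Nontrivial K := Submodule.nontrivial_iff_ne_bot.2 hK0
  have hm : 0 < Module.finrank ℂ K := Module.finrank_pos
  have f := stdOrthonormalBasis ℂ K
  obtain ⟨f₀, hf₀'⟩ : ∃ f₀, f₀ = f ⟨0, hm⟩ := ⟨_, rfl⟩
  have hf₀ : inner ℂ f₀ f₀ = (1 : ℂ) := by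
    rw [hf₀', inner_self_eq_norm_sq_to_K, f.norm_eq_one]
    simp
  have hzero : ∀ T ∈ I, T f₀ = 0 → T = 0 := by
    intro T hT h0
    obtain ⟨z, hz⟩ := hschur T hT T hT
    have h1 := hz f₀ f₀
    rw [h0, inner_zero_left, hf₀, mul_one] at h1
    ext u
    rw [LinearMap.zero_apply, ← inner_self_eq_zero (𝕜 := ℂ), hz, ← h1, zero_mul]
  obtain ⟨L, hL⟩ : ∃ L : Submodule ℂ H, ∀ v, v ∈ L ↔ ∃ T ∈ I, T f₀ = v :=
    ⟨I.map (LinearMap.applyₗ f₀), fun v => Iff.rfl⟩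
  have hf₀L : (f₀ : H) ∈ L := (hL _).2 ⟨K.subtype, (hI _).2 ⟨fun k v => rfl, fun v => hKW v.2⟩, rfl⟩
  have : Nontrivial L := by
    refine Submodule.nontrivial_iff_ne_bot.2 fun h => ?_
    rw [h, Submodule.mem_bot, Submodule.coe_eq_zero] at hf₀L
    rw [hf₀L, inner_zero_left] at hf₀
    exact zero_ne_one hf₀
  have hn : 0 < Module.finrank ℂ L := Module.finrank_pos
  have g := stdOrthonormalBasis ℂ L
  choose T hT hTg using fun ν => (hL _).1 (g ν).2
  have hT' := fun ν => (hI _).1 (hT ν)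
  refine ⟨⟨_, _, hm, hn, fun μ ν => T ν (f μ), ?_, ?_, ?_⟩, ?_⟩
  · rw [orthonormal_iff_ite]
    rintro ⟨μ, ν⟩ ⟨μ', ν'⟩
    obtain ⟨z, hz⟩ := hschur _ (hT ν) _ (hT ν')
    have h1 := hz f₀ f₀
    rw [hf₀, mul_one, hTg, hTg, ← Submodule.coe_inner,
      orthonormal_iff_ite.1 g.orthonormal] at h1
    simp only [hz, ← h1, orthonormal_iff_ite.1 f.orthonormal, Prod.mk.injEq]
    by_cases hμ : μ = μ' <;> by_cases hν : ν = ν' <;> simp [hμ, hν]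
  · intro k
    refine ⟨fun μ' μ => inner ℂ (f μ') (⟨X k (f μ), hK k _ (f μ).2⟩ : K), fun μ ν => ?_⟩
    refine ((hT' ν).1 k (f μ)).symm.trans ?_
    conv_lhs => rw [← f.sum_repr' ⟨X k (f μ), hK k _ (f μ).2⟩, map_sum]
    exact Finset.sum_congr rfl fun _ _ => map_smul _ _ _
  · intro l
    have hYT : ∀ ν, Y l ∘ₗ T ν ∈ I := fun ν =>
      (hI _).2 ⟨fun k v => by rw [LinearMap.comp_apply, (hT' ν).1, ← hXY]; rfl,
        fun v => hWY l _ ((hT' ν).2 v)⟩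
    have hmem : ∀ ν, Y l (g ν) ∈ L := fun ν => (hL _).2 ⟨_, hYT ν, congrArg (Y l) (hTg ν)⟩
    refine ⟨fun ν' ν => inner ℂ (g ν') (⟨Y l (g ν), hmem ν⟩ : L), fun μ ν => ?_⟩
    have h0 := hzero (Y l ∘ₗ T ν - ∑ ν', (inner ℂ (g ν') (⟨Y l (g ν), hmem ν⟩ : L)) • T ν')
      (I.sub_mem (hYT ν) (I.sum_mem fun ν' _ => I.smul_mem _ (hT ν'))) (by
        have h1 := congrArg Subtype.val (g.sum_repr' ⟨Y l (g ν), hmem ν⟩)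
        simp only [LinearMap.sub_apply, LinearMap.comp_apply, LinearMap.sum_apply,
          LinearMap.smul_apply, hTg]
        rw [Submodule.coe_sum] at h1
        exact sub_eq_zero.2 h1.symm)
    have h1 := LinearMap.congr_fun h0 (f μ)
    rw [LinearMap.sub_apply, LinearMap.zero_apply, sub_eq_zero, LinearMap.sum_apply] at h1
    exact h1
  · rw [TensorBlock.space_le]
    exact fun μ ν => (hT' ν).2 _

theorem exists_tensorBlock_decomposition {X : κ → H →ₗ[ℂ] H} {Y : ℓ → H →ₗ[ℂ] H}
    (hX : IsAdjointClosed X) (hY : IsAdjointClosed Y) (hXY : ∀ k l v, X k (Y l v) = Y l (X k v))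
    (W : Submodule ℂ H) (hWX : IsInvariantUnder X W) (hWY : IsInvariantUnder Y W) :
    ∃ (ι : Type) (_ : Fintype ι) (_ : DecidableEq ι) (B : ι → TensorBlock X Y),
      (∀ i j, i ≠ j → (B i).space ⟂ (B j).space) ∧ ⨆ i, (B i).space = W := by
  induction W using WellFoundedLT.induction with
  | ind W ih =>
  by_cases hW0 : W = ⊥
  · exact ⟨Empty, inferInstance, inferInstance, fun i => i.elim, fun i => i.elim, by simp [hW0]⟩
  obtain ⟨B₀, hB₀⟩ := exists_tensorBlock_space_le hX hXY hWX hWY hW0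
  have hlt : B₀.spaceᗮ ⊓ W < W := by
    refine inf_le_right.lt_of_ne fun h => B₀.space_ne_bot ?_
    rw [inf_eq_right] at h
    rw [eq_bot_iff, ← B₀.space.inf_orthogonal_eq_bot]
    exact le_inf le_rfl (hB₀.trans h)
  obtain ⟨ι, _, _, B, hB, hBW⟩ := ih _ hlt ((B₀.invariant_X.orthogonal hX).inf hWX)
    ((B₀.invariant_Y.orthogonal hY).inf hWY)
  have hBi : ∀ i, B₀.space ⟂ (B i).space := fun i => by
    rw [Submodule.isOrtho_iff_le, Submodule.le_orthogonal_iff_le_orthogonal]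
    exact (le_iSup (fun i => (B i).space) i).trans (hBW.le.trans inf_le_left)
  refine ⟨Option ι, inferInstance, inferInstance, fun o => o.elim B₀ B, ?_, ?_⟩
  · rintro (_ | i) (_ | j) hij
    · exact absurd rfl hij
    · exact hBi j
    · exact (hBi i).symm
    · exact hB i j fun h => hij (congrArg some h)
  · rw [iSup_option]
    change B₀.space ⊔ ⨆ i, (B i).space = W
    rw [hBW]
    exact Submodule.sup_orthogonal_inf_of_hasOrthogonalProjection hB₀
end

namespace TensorBlock
variable {H κ ℓ : Type*} [NormedAddCommGroup H] [InnerProductSpace ℂ H]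
  {X : κ → H →ₗ[ℂ] H} {Y : ℓ → H →ₗ[ℂ] H} (B : TensorBlock X Y)

theorem inner_e (μ μ' : Fin B.m) (ν ν' : Fin B.n) :
    inner ℂ (B.e μ ν) (B.e μ' ν') = if μ = μ' ∧ ν = ν' then (1 : ℂ) else 0 :=
  (orthonormal_iff_ite.1 B.orthonormal (μ, ν) (μ', ν')).trans (by simp only [Prod.mk.injEq])

theorem orthonormal_left (ν : Fin B.n) : Orthonormal ℂ fun μ => B.e μ ν :=
  B.orthonormal.comp (fun μ => (μ, ν)) fun _ _ h => congrArg Prod.fst h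

theorem orthonormal_right (μ : Fin B.m) : Orthonormal ℂ fun ν => B.e μ ν :=
  B.orthonormal.comp (fun ν => (μ, ν)) fun _ _ h => congrArg Prod.snd h

/-- On a block, the matrix entries of a product `X k * Y l` factorize. -/
theorem inner_X_Y (k : κ) (l : ℓ) (μ₀ μ μ' : Fin B.m) (ν₀ ν ν' : Fin B.n) :
    inner ℂ (B.e μ ν) (X k (Y l (B.e μ' ν'))) =
      inner ℂ (B.e μ ν₀) (X k (B.e μ' ν₀)) * inner ℂ (B.e μ₀ ν) (Y l (B.e μ₀ ν')) := by
  obtain ⟨x, hx⟩ := B.actX k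
  obtain ⟨y, hy⟩ := B.actY l
  have h1 : inner ℂ (B.e μ ν₀) (X k (B.e μ' ν₀)) = x μ μ' := by
    simp [hx, inner_e]
  have h2 : inner ℂ (B.e μ₀ ν) (Y l (B.e μ₀ ν')) = y ν ν' := by
    simp [hy, inner_e]
  rw [h1, h2]
  simp [hx, hy, inner_e, ite_and, mul_comm]

end TensorBlock

theorem extB_mul_extC_apply {b c a : Type*} [Fintype a] [Fintype b] [Fintype c]
    [DecidableEq b] [DecidableEq c]
    (M : Matrix (b × a) (b × a) ℂ) (N : Matrix (c × a) (c × a) ℂ) (β β' : b) (γ γ' : c) (x x' : a) :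
    (extB M * extC N : Matrix ((b × c) × a) ((b × c) × a) ℂ) ((β, γ), x) ((β', γ'), x') =
      ∑ x₁, M (β, x) (β', x₁) * N (γ, x₁) (γ', x') := by
  simp only [mul_apply, Fintype.sum_prod_type, extB, extC, of_apply]
  rw [Finset.sum_eq_single β', Finset.sum_eq_single γ]
  · simp
  · intro γ₁ _ h; simp [h.symm]
  · simp
  · intro β₁ _ h; simp [h]
  · simp

theorem extC_mul_extB_apply {b c a : Type*} [Fintype a] [Fintype b] [Fintype c]
    [DecidableEq b] [DecidableEq c]
    (M : Matrix (b × a) (b × a) ℂ) (N : Matrix (c × a) (c × a) ℂ) (β β' : b) (γ γ' : c) (x x' : a) :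
    (extC N * extB M : Matrix ((b × c) × a) ((b × c) × a) ℂ) ((β, γ), x) ((β', γ'), x') =
      ∑ x₁, N (γ, x) (γ', x₁) * M (β, x₁) (β', x') := by
  simp only [mul_apply, Fintype.sum_prod_type, extB, extC, of_apply]
  rw [Finset.sum_eq_single β, Finset.sum_eq_single γ']
  · simp
  · intro γ₁ _ h; simp [h]
  · simp
  · intro β₁ _ h; simp [h.symm]
  · simp

section
variable {b c a : Type*} [Fintype a] [DecidableEq a]

theorem inner_toEuclideanLin (A : Matrix a a ℂ) (u v : EuclideanSpace ℂ a) :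
    inner ℂ u (toEuclideanLin A v) = ∑ x, ∑ x', star (u x) * A x x' * v x' := by
  rw [EuclideanSpace.inner_eq_star_dotProduct, ofLp_toLpLin, toLin'_apply]
  simp only [dotProduct, mulVec, Finset.sum_mul, Pi.star_apply]
  exact Finset.sum_congr rfl fun x _ => Finset.sum_congr rfl fun x' _ => by ring

/-- The operator `M_{ββ'}` on the second tensor factor which is the `(β, β')` block of `M`. -/
def slice (M : Matrix (b × a) (b × a) ℂ) (k : b × b) :
    EuclideanSpace ℂ a →ₗ[ℂ] EuclideanSpace ℂ a :=
  toEuclideanLin (of fun x x' => M (k.1, x) (k.2, x'))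

theorem inner_slice (M : Matrix (b × a) (b × a) ℂ) (k : b × b) (u v : EuclideanSpace ℂ a) :
    inner ℂ u (slice M k v) = ∑ x, ∑ x', star (u x) * M (k.1, x) (k.2, x') * v x' :=
  inner_toEuclideanLin _ _ _

theorem isAdjointClosed_slice {M : Matrix (b × a) (b × a) ℂ} (hM : M.IsHermitian) :
    IsAdjointClosed (slice M) := by
  rintro ⟨β, β'⟩
  refine ⟨(β', β), fun u v => ?_⟩
  rw [← inner_conj_symm, inner_slice, inner_slice, map_sum, Finset.sum_comm]
  simp only [map_sum]
  refine Finset.sum_congr rfl fun x _ => Finset.sum_congr rfl fun x' _ => ?_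
  rw [← hM.apply (β', x') (β, x)]
  simp
  ring

/-- The compression of `M` along a family of vectors of the second tensor factor. -/
def compress {σ : Type*} (M : Matrix (b × a) (b × a) ℂ) (v : σ → EuclideanSpace ℂ a) :
    Matrix (b × σ) (b × σ) ℂ :=
  of fun p q => inner ℂ (v p.2) (slice M (p.1, q.1) (v q.2))

theorem compress_posSemidef {σ : Type*} [Finite σ] [Fintype b] [DecidableEq b]
    {M : Matrix (b × a) (b × a) ℂ} (hM : M.PosSemidef) (v : σ → EuclideanSpace ℂ a) :
    (compress M v).PosSemidef := by
  convert hM.conjTranspose_mul_mul_same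
    (of fun (p : b × a) (q : b × σ) => if p.1 = q.1 then v q.2 p.2 else 0) using 1
  ext ⟨β, μ⟩ ⟨β', μ'⟩
  simp only [compress, of_apply, inner_slice, mul_apply, Fintype.sum_prod_type,
    conjTranspose_apply, Finset.sum_mul]
  rw [Finset.sum_comm (s := Finset.univ (α := a))]
  simp [apply_ite, ite_mul]

theorem ptrace₁_compress {σ : Type*} [Fintype b] [DecidableEq σ] {M : Matrix (b × a) (b × a) ℂ}
    (hM : ptrace₁ M = 1) {v : σ → EuclideanSpace ℂ a} (hv : Orthonormal ℂ v) :
    ptrace₁ (compress M v) = 1 := by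
  have h : ∑ β, slice M (β, β) = LinearMap.id := by
    rw [← toLpLin_one, ← hM]
    simp only [slice, ← map_sum]
    congr 1
    ext
    simp [ptrace₁, Matrix.sum_apply]
  ext μ μ'
  simp only [ptrace₁, compress, of_apply, ← inner_sum, ← LinearMap.sum_apply, h, one_apply]
  exact orthonormal_iff_ite.1 hv μ μ'

theorem inner_slice_slice (M : Matrix (b × a) (b × a) ℂ) (N : Matrix (c × a) (c × a) ℂ)
    (k : b × b) (l : c × c) (u v : EuclideanSpace ℂ a) :
    inner ℂ u (slice M k (slice N l v)) = ∑ x, ∑ x', star (u x) *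
      (∑ x₁, M (k.1, x) (k.2, x₁) * N (l.1, x₁) (l.2, x')) * v x' := by
  rw [slice, slice, ← LinearMap.comp_apply, ← toLpLin_mul, inner_toEuclideanLin]
  rfl

theorem slice_comm [Fintype b] [Fintype c] [DecidableEq b] [DecidableEq c]
    {M : Matrix (b × a) (b × a) ℂ} {N : Matrix (c × a) (c × a) ℂ}
    (h : (extB M * extC N : Matrix ((b × c) × a) ((b × c) × a) ℂ) = extC N * extB M)
    (k : b × b) (l : c × c) (v : EuclideanSpace ℂ a) :
    slice M k (slice N l v) = slice N l (slice M k v) := by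
  refine ext_inner_left ℂ fun u => ?_
  rw [inner_slice_slice, inner_slice_slice]
  refine Finset.sum_congr rfl fun x _ => Finset.sum_congr rfl fun x' _ => ?_
  rw [← extB_mul_extC_apply, h, extC_mul_extB_apply]

/-- In a basis `e`, the entries of a product of commuting extensions are given by the slices. -/
theorem conjOnA_extB_mul_extC [Fintype b] [Fintype c] [DecidableEq b] [DecidableEq c] {σ : Type*}
    {M : Matrix (b × a) (b × a) ℂ} {N : Matrix (c × a) (c × a) ℂ}
    {ρ : Matrix ((b × c) × a) ((b × c) × a) ℂ} (h : extB M * extC N = ρ)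
    (e : σ → EuclideanSpace ℂ a) (β β' : b) (γ γ' : c) (s t : σ) :
    conjOnA ρ (of fun s x => star (e s x)) ((β, γ), s) ((β', γ'), t) =
      inner ℂ (e s) (slice M (β, β') (slice N (γ, γ') (e t))) := by
  rw [inner_slice_slice, ← h]
  simp only [conjOnA, of_apply, extB_mul_extC_apply, star_star]

theorem isUnitaryMat_of_orthonormal {σ : Type*} [Fintype σ] [DecidableEq σ]
    {e : σ → EuclideanSpace ℂ a} (he : Orthonormal ℂ e) (hcard : Fintype.card σ = Fintype.card a) :
    IsUnitaryMat (of fun s x => star (e s x) : Matrix σ a ℂ) := by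
  have h : (of fun s x => star (e s x) : Matrix σ a ℂ) * (of fun s x => star (e s x))ᴴ = 1 := by
    ext s t
    rw [one_apply, ← orthonormal_iff_ite.1 he, EuclideanSpace.inner_eq_star_dotProduct]
    simp [mul_apply, dotProduct, mul_comm]
  exact ⟨h, (mul_eq_one_comm_of_card_eq _ _ _ hcard).1 h⟩

end

/-- A channel operator which is the product of its commuting marginals has a block form. -/
theorem nonempty_commonCauseBlockForm {b c a : Type*} [Fintype b] [Fintype c] [Fintype a]
    [DecidableEq a] [DecidableEq b] [DecidableEq c] {ρ : Matrix ((b × c) × a) ((b × c) × a) ℂ}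
    (hρ : IsCJChannel ρ) (h1 : extB (margB ρ) * extC (margC ρ) = ρ)
    (h2 : extC (margC ρ) * extB (margB ρ) = ρ) : Nonempty (CommonCauseBlockForm ρ) := by
  have hM := margB_posSemidef hρ.1
  have hN := margC_posSemidef hρ.1
  have hM1 : ptrace₁ (margB ρ) = 1 := (ptrace₁_margB ρ).trans hρ.2
  have hN1 : ptrace₁ (margC ρ) = 1 := (ptrace₁_margC ρ).trans hρ.2
  obtain ⟨ι, _, _, B, hB, hBtop⟩ := exists_tensorBlock_decomposition
    (isAdjointClosed_slice hM.1) (isAdjointClosed_slice hN.1)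
    (slice_comm (h1.trans h2.symm)) ⊤ (fun _ _ _ => trivial) (fun _ _ _ => trivial)
  let e : (Σ i, Fin (B i).m × Fin (B i).n) → EuclideanSpace ℂ a := fun s => (B s.1).e s.2.1 s.2.2
  have he : Orthonormal ℂ e := by
    rw [orthonormal_iff_ite]
    rintro ⟨i, p⟩ ⟨j, q⟩
    by_cases hij : i = j
    · subst hij
      exact (orthonormal_iff_ite.1 (B i).orthonormal p q).trans (by simp)
    · rw [if_neg fun h => hij (congrArg Sigma.fst h)]
      exact (hB i j hij).inner_eq ((B i).e_mem_space _ _) ((B j).e_mem_space _ _)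
  have hspan : ⊤ ≤ Submodule.span ℂ (Set.range e) := by
    rw [← hBtop]
    exact iSup_le fun i => ((B i).space_le).2 fun μ ν => Submodule.subset_span ⟨⟨i, μ, ν⟩, rfl⟩
  have hcard : Fintype.card (Σ i, Fin (B i).m × Fin (B i).n) = Fintype.card a := by
    rw [← finrank_euclideanSpace (𝕜 := ℂ) (ι := a),
      Module.finrank_eq_card_basis (OrthonormalBasis.mk he hspan).toBasis]
  refine ⟨
    { ι := ι
      m := fun i => (B i).m
      n := fun i => (B i).n
      card_eq := by rw [← hcard]; simp
      V := of fun s x => star (e s x)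
      hV := isUnitaryMat_of_orthonormal he hcard
      ρB := fun i => compress (margB ρ) fun μ => (B i).e μ ⟨0, (B i).n_pos⟩
      ρC := fun i => compress (margC ρ) fun ν => (B i).e ⟨0, (B i).m_pos⟩ ν
      hρB := fun i => ⟨compress_posSemidef hM _, ptrace₁_compress hM1 ((B i).orthonormal_left _)⟩
      hρC := fun i => ⟨compress_posSemidef hN _, ptrace₁_compress hN1 ((B i).orthonormal_right _)⟩
      offdiag := ?_
      diag := ?_ }⟩
  · intro β β' γ γ' s t hst
    refine (conjOnA_extB_mul_extC h1 e _ _ _ _ _ _).trans ?_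
    exact (hB _ _ hst).inner_eq ((B s.1).e_mem_space _ _)
      ((B t.1).invariant_X _ _ ((B t.1).invariant_Y _ _ ((B t.1).e_mem_space _ _)))
  · intro i μ μ' ν ν' β β' γ γ'
    refine (conjOnA_extB_mul_extC h1 e _ _ _ _ _ _).trans ?_
    exact (B i).inner_X_Y _ _ _ _ _ _ _ _

/-- Theorem 3, 3 ⇒ 4: if the quantum conditional mutual information `I(B:C|A)` of the
normalized channel operator vanishes, then the channel admits a common-cause block form. -/
theorem cmi_zero_implies_blockform (ρ : Matrix ((b × c) × a) ((b × c) × a) ℂ)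
    (hρ : IsCJChannel ρ)
    (hcmi : qcmiBCA ((1 / (Fintype.card a : ℂ)) • ρ) = 0) :
    Nonempty (CommonCauseBlockForm ρ) := by
  obtain ⟨h1, h2⟩ := extB_mul_extC_of_qcmiBCA_eq_zero hρ hcmi
  exact nonempty_commonCauseBlockForm hρ h1 h2

end
end
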